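/- Fix n ≥ 0 and j ≥ 2n, and let s : B_{n,2j} → {0,1}^j be the map sending b to the binary string whose ℓ-th entry is 0 if point 2ℓ-1 of b is bare and 1 otherwise. Then for every binary string w of length j with exactly n ones, the fiber s^{-1}(w) has exactly 4^n elements. -/

import Mathlib

/-- Colours for the chords of a diagram in the class `𝓑`. -/
inductive ChordColor : Type
  | red
  | blue
  | black
  deriving DecidableEq

/-- Raw data of a coloured partial rooted chord diagram on the points `{0, …, m-1}`
(cyclically ordered): `mate x` is the other end of the chord on `x` (or `none` if `x` is bare),
`color x` is the colour of the chord on `x`, and `first x` records whether `x` is the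
designated first end of a red or blue chord. -/
structure DiagramData (m : ℕ) where
  mate : Fin m → Option (Fin m)
  color : Fin m → ChordColor
  first : Fin m → Bool

namespace DiagramData

variable {m : ℕ}

/-- Position of `y` measured cyclically (counterclockwise) from `a`. -/
def rel (a y : Fin m) : ℕ := (y.val + m - a.val) % m

/-- `z` lies strictly inside the cyclic interval running from the first end `a`
to the other end `c`. -/
def InsideCyc (a c z : Fin m) : Prop := 0 < rel a z ∧ rel a z < rel a c

instance (a c z : Fin m) : Decidable (InsideCyc a c z) := by
  unfold InsideCyc; infer_instance

/-- The point lying `s` steps cyclically before `x`. -/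
def cycPred (x : Fin m) (s : ℕ) : Fin m :=
  ⟨(x.val + s * (m - 1)) % m, Nat.mod_lt _ x.pos⟩

/-- `x` is a bare point of `b` (a singleton part of the partition). -/
def IsBare (b : DiagramData m) (x : Fin m) : Prop := b.mate x = none

/-- `mate` describes a partial matching: parts of size one or two. -/
def IsMatching (b : DiagramData m) : Prop :=
  (∀ x y, b.mate x = some y → b.mate y = some x) ∧ ∀ x, b.mate x ≠ some x

/-- No two chords cross (in the linear order on the points). -/
def Noncrossing (b : DiagramData m) : Prop :=
  ∀ x y u v, b.mate x = some y → b.mate u = some v → x < u → u < y → y < v → False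

/-- Colours are attached to chords (both ends agree), and bare points carry the
default colour black. -/
def ColorOK (b : DiagramData m) : Prop :=
  (∀ x y, b.mate x = some y → b.color x = b.color y) ∧
    ∀ x, b.mate x = none → b.color x = ChordColor.black

/-- Exactly the red and blue chords have a designated first end, one per chord. -/
def FirstOK (b : DiagramData m) : Prop :=
  (∀ x, b.first x = true → (b.mate x).isSome ∧ b.color x ≠ ChordColor.black) ∧
    ∀ x y, b.mate x = some y → b.color x ≠ ChordColor.black → b.first x = !b.first y

/-- Every point inside a red or blue chord lies on a black chord, and every black
chord lies inside some red or blue chord. -/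
def InsideOK (b : DiagramData m) : Prop :=
  (∀ x y, b.mate x = some y → b.first x = true →
      ∀ z, InsideCyc x y z → (b.mate z).isSome ∧ b.color z = ChordColor.black) ∧
    ∀ z w, b.mate z = some w → b.color z = ChordColor.black →
      ∃ x y, b.mate x = some y ∧ b.first x = true ∧ InsideCyc x y z ∧ InsideCyc x y w

/-- Membership in the set `𝓑_{n,m}` of the paper: a noncrossing coloured partial rooted
chord diagram with `n` chords on `m` points, black chords exactly filling the insides
of the red and blue chords. -/
def MemB (n : ℕ) (b : DiagramData m) : Prop :=
  b.IsMatching ∧ b.Noncrossing ∧ b.ColorOK ∧ b.FirstOK ∧ b.InsideOK ∧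
    (Finset.univ.filter fun x : Fin m => (b.mate x).isSome).card = 2 * n

/-- Width of the red or blue chord with first end `x`: one plus the number of black
chords inside it. -/
def width (b : DiagramData m) (x : Fin m) : ℕ :=
  1 + (Finset.univ.filter fun z : Fin m =>
        ∃ w y, b.mate z = some w ∧ z < w ∧ b.color z = ChordColor.black ∧
          b.mate x = some y ∧ InsideCyc x y z ∧ InsideCyc x y w).card

/-- Sum of the widths of the red/blue chords whose first ends precede `x`. -/
def prefixWidth (b : DiagramData m) (x : Fin m) : ℕ :=
  ∑ y ∈ Finset.univ.filter (fun y : Fin m => b.first y = true ∧ y < x), b.width y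

/-- Membership in the set `𝓑_{n,m,c,e}` of the paper: an element of `𝓑_{n,m}` such that
for every first end `e_j` (in increasing order) with `w(e_1) + ⋯ + w(e_{j-1}) < e`, there
are fewer than `c` consecutive bare points immediately cyclically preceding `e_j`
(equivalently, one of the `c` points cyclically preceding `e_j` is not bare). -/
def MemBFull (n c e : ℕ) (b : DiagramData m) : Prop :=
  b.MemB n ∧ ∀ x, b.first x = true → b.prefixWidth x < e →
    ∃ s, 1 ≤ s ∧ s ≤ c ∧ ¬ b.IsBare (cycPred x s)

end DiagramData

/-- The binary string `s(b)` of a diagram `b ∈ 𝓑_{n,2j}`: its `ℓ`-th entry is `false` (`0`)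
if point `2ℓ-1` of `b` is bare and `true` (`1`) otherwise. -/
def sMap {j : ℕ} (b : DiagramData (2 * j)) : Fin j → Bool :=
  fun ℓ => (b.mate ⟨2 * ℓ.val, by have := ℓ.isLt; omega⟩).isSome

/-- The role of a point in a diagram read from left to right: bare, the left end of a red, blue
or black chord, or the right end of a chord. -/
inductive PointKind : Type
  | bare
  | red
  | blue
  | inner
  | close
  deriving DecidableEq

namespace PointKind

instance : Fintype PointKind :=
  ⟨{bare, red, blue, inner, close}, fun s => by cases s <;> decide⟩

/-- `Step s a a'`: a point of kind `s` may have `a` chords passing over the gap on its left and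
`a'` chords passing over the gap on its right. -/
def Step : PointKind → ℕ → ℕ → Prop
  | bare, a, a' => a = 0 ∧ a' = 0
  | red, a, a' => a = 0 ∧ a' = 1
  | blue, a, a' => a = 0 ∧ a' = 1
  | inner, a, a' => 1 ≤ a ∧ a' = a + 1
  | close, a, a' => a = a' + 1

/-- `A` is the height function of the word `t`: it ends at `0` and makes legal steps. -/
def IsHeight {k : ℕ} (A : ℕ → ℕ) (t : Fin k → PointKind) : Prop :=
  A k = 0 ∧ ∀ i : Fin k, (t i).Step (A i) (A (i + 1))

/-- A point of kind `s` obeys the constraint `o`: `some true` demands a chord end, `some false`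
demands a bare point, `none` demands nothing. -/
def Allowed (o : Option Bool) (s : PointKind) : Prop :=
  ∀ v, o = some v → (v = true ↔ s ≠ bare)

/-- Words obeying the constraints `c`, with a height function starting at `a`, and with `z`
bare points. -/
def Accepted {k : ℕ} (c : Fin k → Option Bool) (a z : ℕ) (t : Fin k → PointKind) : Prop :=
  (∃ A, A 0 = a ∧ IsHeight A t) ∧ (∀ i, Allowed (c i) (t i)) ∧
    (Finset.univ.filter fun i => t i = bare).card = z

/-- The number of accepted words. -/
noncomputable def numWords {k : ℕ} (c : Fin k → Option Bool) (a z : ℕ) : ℕ :=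
  Nat.card {t : Fin k → PointKind // Accepted c a z t}

theorem accepted_cons {k : ℕ} (c : Fin (k + 1) → Option Bool) (a z : ℕ) (s : PointKind)
    (t : Fin k → PointKind) :
    Accepted c a z (Fin.cons s t : Fin (k + 1) → PointKind) ↔
      Allowed (c 0) s ∧ ∃ a' z', s.Step a a' ∧ z = z' + (if s = bare then 1 else 0) ∧
        Accepted (fun i => c i.succ) a' z' t := by
  have hcard : (Finset.univ.filter fun i =>
      (Fin.cons s t : Fin (k + 1) → PointKind) i = bare).card
      = (Finset.univ.filter fun i => t i = bare).card + (if s = bare then 1 else 0) := by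
    rw [Finset.card_filter, Finset.card_filter, Fin.sum_univ_succ]
    simp [add_comm]
  unfold Accepted IsHeight
  rw [hcard]
  constructor
  · rintro ⟨⟨A, rfl, hA, hs⟩, hc, rfl⟩
    rw [Fin.forall_fin_succ] at hs hc
    refine ⟨by simpa using hc.1, A 1, _, by simpa using hs.1, rfl,
      ⟨fun i => A (i + 1), rfl, hA, fun i => by simpa using hs.2 i⟩,
      fun i => by simpa using hc.2 i, rfl⟩
  · rintro ⟨hc0, a', z', hs, rfl, ⟨A, rfl, hA, hsA⟩, hc, rfl⟩
    refine ⟨⟨fun i => Nat.casesOn i a A, rfl, hA, ?_⟩, ?_, rfl⟩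
    · rw [Fin.forall_fin_succ]
      exact ⟨by simpa using hs, fun i => by simpa using hsA i⟩
    · rw [Fin.forall_fin_succ]
      exact ⟨by simpa using hc0, fun i => by simpa using hc i⟩

theorem numWords_succ {k : ℕ} (c : Fin (k + 1) → Option Bool) (a z : ℕ) :
    numWords c a z = ∑ s : PointKind, Nat.card {t : Fin k → PointKind //
      Allowed (c 0) s ∧ ∃ a' z', s.Step a a' ∧ z = z' + (if s = bare then 1 else 0) ∧
        Accepted (fun i => c i.succ) a' z' t} := by
  rw [← Nat.card_sigma]
  refine Nat.card_congr ⟨fun t => ⟨t.1 0, Fin.tail t.1, ?_⟩, fun p => ⟨Fin.cons p.1 p.2.1, ?_⟩,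
    ?_, ?_⟩
  · rw [← accepted_cons, Fin.cons_self_tail]; exact t.2
  · rw [accepted_cons]; exact p.2.2
  · intro t; simp
  · rintro ⟨s, t, h⟩; rfl

theorem univ_eq : (Finset.univ : Finset PointKind) = {bare, red, blue, inner, close} := rfl

theorem card_false {α : Type*} {p : α → Prop} (h : ∀ x, ¬ p x) : Nat.card {x // p x} = 0 := by
  have : IsEmpty {x // p x} := ⟨fun x => h _ x.2⟩
  exact Nat.card_of_isEmpty

theorem card_step {k : ℕ} {c : Fin k → Option Bool} {o : Option Bool} {a z a' : ℕ}
    {s : PointKind} (ho : Allowed o s) (hs : s ≠ bare) (h : s.Step a a') 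
    (hu : ∀ b, s.Step a b → b = a') :
    Nat.card {t : Fin k → PointKind // Allowed o s ∧ ∃ a' z', s.Step a a' ∧
      z = z' + (if s = bare then 1 else 0) ∧ Accepted c a' z' t} = numWords c a' z := by
  unfold numWords
  congr! with t
  constructor
  · rintro ⟨-, b, z', h1, h2, h3⟩
    obtain rfl := hu b h1
    simp only [hs, if_false, add_zero] at h2
    exact h2 ▸ h3
  · intro ht
    exact ⟨ho, a', z, h, by simp [hs], ht⟩

theorem numWords_zero (c : Fin 0 → Option Bool) (a z : ℕ) :
    numWords c a z = if a = 0 ∧ z = 0 then 1 else 0 := by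
  split_ifs with h
  · obtain ⟨rfl, rfl⟩ := h
    have : Nonempty {t : Fin 0 → PointKind // Accepted c 0 0 t} :=
      ⟨Fin.elim0, ⟨fun _ => 0, rfl, rfl, fun i => i.elim0⟩, fun i => i.elim0, by simp⟩
    exact Nat.card_unique
  · refine card_false fun t ht => h ?_
    obtain ⟨⟨A, rfl, hA, -⟩, -, hz⟩ := ht
    exact ⟨hA, by simpa using hz.symm⟩

/-- Extensions of a word by a bare point. -/
theorem card_bare {k : ℕ} (c : Fin k → Option Bool) {o : Option Bool} (ho : o ≠ some true)
    (a z : ℕ) :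
    Nat.card {t : Fin k → PointKind // Allowed o bare ∧ ∃ a' z', bare.Step a a' ∧
      z = z' + (if bare = bare then 1 else 0) ∧ Accepted c a' z' t} =
      if a = 0 ∧ z ≠ 0 then numWords c 0 (z - 1) else 0 := by
  have ho' : Allowed o bare := by
    intro v hv
    cases v <;> simp_all
  by_cases h : a = 0 ∧ z ≠ 0
  · rw [if_pos h]
    unfold numWords
    congr! with t
    constructor
    · rintro ⟨-, b, z', ⟨-, rfl⟩, rfl, h3⟩
      simpa using h3
    · intro ht
      refine ⟨ho', 0, z - 1, ⟨h.1, rfl⟩, ?_, ht⟩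
      simp only [if_true]
      omega
  · rw [if_neg h]
    refine card_false ?_
    rintro t ⟨-, b, z', ⟨rfl, rfl⟩, rfl, -⟩
    simp at h

theorem allowed_of_ne {o : Option Bool} {s : PointKind} (ho : o ≠ some false) (hs : s ≠ bare) :
    Allowed o s := by
  intro v hv
  cases v <;> simp_all

/-- Words beginning with a chord end. -/
noncomputable def numChord {k : ℕ} (c : Fin k → Option Bool) (a z : ℕ) : ℕ :=
  if a = 0 then 2 * numWords c 1 z else numWords c (a + 1) z + numWords c (a - 1) z

theorem card_chord {k : ℕ} (c : Fin k → Option Bool) {o : Option Bool} (ho : o ≠ some false)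
    (a z : ℕ) :
    ∑ s ∈ {red, blue, inner, close}, Nat.card {t : Fin k → PointKind //
      Allowed o s ∧ ∃ a' z', s.Step a a' ∧ z = z' + (if s = bare then 1 else 0) ∧
        Accepted c a' z' t} = numChord c a z := by
  rw [Finset.sum_insert (by decide), Finset.sum_insert (by decide), Finset.sum_insert (by decide),
    Finset.sum_singleton]
  unfold numChord
  by_cases ha : a = 0
  · rw [if_pos ha, card_step (s := red) (allowed_of_ne ho (by decide)) (by decide) (a' := 1) ⟨ha, rfl⟩
        (fun b h => h.2),
      card_step (s := blue) (allowed_of_ne ho (by decide)) (by decide) (a' := 1) ⟨ha, rfl⟩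
        (fun b h => h.2),
      card_false, card_false]
    · ring
    · rintro t ⟨-, b, z', h, -⟩
      simp only [Step] at h
      omega
    · rintro t ⟨-, b, z', h, -⟩
      simp only [Step] at h
      omega
  · rw [if_neg ha, card_step (s := inner) (allowed_of_ne ho (by decide)) (by decide) (a' := a + 1)
        ⟨by omega, rfl⟩ (fun b h => h.2),
      card_step (s := close) (allowed_of_ne ho (by decide)) (by decide) (a' := a - 1)
        (show a = a - 1 + 1 by omega) (fun b h => by simp only [Step] at h; omega),
      card_false, card_false]
    · ring
    · rintro t ⟨-, b, z', h, -⟩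
      exact ha h.1
    · rintro t ⟨-, b, z', h, -⟩
      exact ha h.1

theorem numWords_succ_none {k : ℕ} (c : Fin (k + 1) → Option Bool) (hc : c 0 = none) (a z : ℕ) :
    numWords c a z = (if a = 0 ∧ z ≠ 0 then numWords (fun i => c i.succ) 0 (z - 1) else 0) +
      numChord (fun i => c i.succ) a z := by
  rw [numWords_succ, univ_eq, Finset.sum_insert (by decide), card_bare _ (by simp [hc]),
    card_chord _ (by simp [hc])]

theorem numWords_succ_true {k : ℕ} (c : Fin (k + 1) → Option Bool) (hc : c 0 = some true)
    (a z : ℕ) : numWords c a z = numChord (fun i => c i.succ) a z := by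
  rw [numWords_succ, univ_eq, Finset.sum_insert (by decide), card_chord _ (by simp [hc]),
    card_false, zero_add]
  rintro t ⟨h, -⟩
  simpa using (h true hc)

theorem numWords_succ_false {k : ℕ} (c : Fin (k + 1) → Option Bool) (hc : c 0 = some false)
    (a z : ℕ) : numWords c a z =
      if a = 0 ∧ z ≠ 0 then numWords (fun i => c i.succ) 0 (z - 1) else 0 := by
  rw [numWords_succ, univ_eq, Finset.sum_insert (by decide), card_bare _ (by simp [hc]),
    Finset.sum_eq_zero, add_zero]
  intro s hs
  refine card_false ?_
  rintro t ⟨h, -⟩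
  have h' := h false hc
  have : s = bare := by simpa using h'
  subst this
  simp at hs

end PointKind

/-- The number of `±1` walks of length `s` from `a` to `0`. -/
def walksTo : ℕ → ℤ → ℕ
  | 0, a => if a = 0 then 1 else 0
  | s + 1, a => walksTo s (a - 1) + walksTo s (a + 1)

/-- The number of `±1` walks of length `s` from `a` to a negative number. -/
def walksBelow : ℕ → ℤ → ℕ
  | 0, a => if a < 0 then 1 else 0
  | s + 1, a => walksBelow s (a - 1) + walksBelow s (a + 1)

theorem walksTo_neg (s : ℕ) (a : ℤ) : walksTo s (-a) = walksTo s a := by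
  induction s generalizing a with
  | zero => simp [walksTo]
  | succ s ih =>
    simp only [walksTo]
    rw [← ih (a - 1), ← ih (a + 1), add_comm]
    congr 2 <;> ring

theorem walksTo_eq_zero (s : ℕ) (a : ℤ) (h : (s + a) % 2 = 1) : walksTo s a = 0 := by
  induction s generalizing a with
  | zero => simp only [walksTo]; rw [if_neg]; rintro rfl; simp at h
  | succ s ih =>
    simp only [walksTo]
    push_cast at h
    rw [ih _ (by omega), ih _ (by omega)]

theorem walksBelow_pred (s : ℕ) (a : ℤ) :
    walksBelow s (a - 1) = walksBelow s a + walksTo s a := by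
  induction s generalizing a with
  | zero => simp only [walksBelow, walksTo]; split_ifs <;> omega
  | succ s ih =>
    simp only [walksBelow, walksTo]
    have h1 := ih (a - 1)
    have h2 := ih (a + 1)
    rw [show a - 1 + 1 = a + 1 - 1 by ring]
    omega

theorem walksBelow_add (s : ℕ) (a : ℤ) :
    walksBelow s a + walksBelow s (-a) + walksTo s a = 2 ^ s := by
  induction s generalizing a with
  | zero => simp only [walksBelow, walksTo]; split_ifs <;> omega
  | succ s ih =>
    simp only [walksBelow, walksTo]
    have h1 := ih (a - 1)
    have h2 := ih (a + 1)
    rw [show -(a - 1) = -a + 1 by ring] at h1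
    rw [show -(a + 1) = -a - 1 by ring] at h2
    rw [pow_succ]
    omega

theorem walksBelow_odd_zero (r : ℕ) : walksBelow (2 * r + 1) 0 = 4 ^ r := by
  have h := walksBelow_add (2 * r + 1) 0
  rw [walksTo_eq_zero _ _ (by push_cast; omega), neg_zero, pow_succ, pow_mul] at h
  norm_num at h
  omega

theorem walksBelow_succ_zero (s : ℕ) (hs : s % 2 = 0) :
    walksBelow (s + 1) 0 = 2 * walksBelow s 1 + walksTo s 0 := by
  simp only [walksBelow]
  have h1 := walksBelow_pred s 0
  have h2 := walksBelow_pred s 1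
  rw [walksTo_eq_zero _ _ (by omega), sub_self] at h2
  rw [h1, zero_add]
  omega

theorem walksTo_succ_zero (s : ℕ) : walksTo (s + 1) 0 = 2 * walksTo s 1 := by
  simp only [walksTo]
  rw [zero_sub, walksTo_neg, zero_add]
  omega

namespace PointKind

/-- The constraints saying that the `ℓ`-th even point is bare exactly if `w ℓ = false`. -/
def evenConstraint {j : ℕ} (w : Fin j → Bool) : Fin (2 * j) → Option Bool :=
  fun i => if i.val % 2 = 0 then some (w ⟨i.val / 2, by omega⟩) else none

theorem evenConstraint_tail {j : ℕ} (w : Fin (j + 1) → Bool) :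
    (fun i : Fin (2 * j) => evenConstraint w (Fin.succ (Fin.succ i))) =
      evenConstraint (fun i => w i.succ) := by
  funext i
  unfold evenConstraint
  simp only [Fin.val_succ, Nat.add_assoc, Nat.reduceAdd, Nat.add_mod_right]
  congr! 4
  simp

theorem evenConstraint_zero {j : ℕ} (w : Fin (j + 1) → Bool) :
    evenConstraint w (0 : Fin (2 * j + 1 + 1)) = some (w 0) := by
  have h : (⟨0 / 2, by omega⟩ : Fin (j + 1)) = 0 := Fin.ext (by simp)
  rw [← h]
  rfl

/-- The number of completions of a walk at height `a` when `s` points remain before the next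
prescribed bare point, provided exactly as many bare points as necessary may be used. -/
def completions (s a : ℕ) : ℕ :=
  if (s + a) % 2 = 0 then walksTo s a else walksBelow s a

theorem completions_succ_pos (s a : ℕ) (ha : a ≠ 0) :
    completions (s + 1) a = completions s (a + 1) + completions s (a - 1) := by
  unfold completions
  obtain ⟨b, rfl⟩ := Nat.exists_eq_succ_of_ne_zero ha
  simp only [walksTo, walksBelow, Nat.succ_eq_add_one, Nat.add_sub_cancel]
  push_cast
  rw [add_sub_cancel_right]
  split_ifs <;> omega

theorem completions_odd_zero (s : ℕ) (hs : s % 2 = 1) :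
    completions (s + 1) 0 = 2 * completions s 1 := by
  unfold completions
  rw [if_pos (by omega), if_pos (by omega)]
  exact_mod_cast walksTo_succ_zero s

theorem completions_even_zero (s : ℕ) (hs : s % 2 = 0) :
    completions (s + 1) 0 = 2 * completions s 1 + completions s 0 := by
  unfold completions
  rw [if_neg (by omega), if_neg (by omega), if_pos (by omega)]
  exact_mod_cast walksBelow_succ_zero s hs

/-- The words obeying `c` with at most `m` (respectively `m + 1`, at odd height) bare points are
those counted by `completions s`, up to a constant factor `N`. -/
def CountedBy {k : ℕ} (c : Fin k → Option Bool) (p m s N : ℕ) : Prop :=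
  ∀ a z, (z < m + (a + p) % 2 → numWords c a z = 0) ∧
    (z = m + (a + p) % 2 → numWords c a z = completions s a * N)

theorem CountedBy.none_succ {k : ℕ} {c : Fin (k + 1) → Option Bool} (hc : c 0 = none)
    {m s N : ℕ} (hs : s % 2 = 0) (h : CountedBy (fun i => c i.succ) 0 m s N) :
    CountedBy c 1 m (s + 1) N := by
  intro a z
  rw [numWords_succ_none c hc]
  unfold numChord
  by_cases ha : a = 0
  · subst ha
    simp only [true_and, if_true, zero_add]
    constructor
    · intro hz
      rw [(h 1 z).1 (by omega)]
      split_ifs with h0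
      · rw [(h 0 (z - 1)).1 (by omega)]
      · rfl
    · intro hz
      rw [(h 1 z).2 (by omega), if_pos (by omega), (h 0 (z - 1)).2 (by omega),
        completions_even_zero s hs]
      ring
  · simp only [ha, false_and, if_false, zero_add]
    constructor
    · intro hz
      rw [(h _ z).1 (by omega), (h _ z).1 (by omega)]
    · intro hz
      rw [(h _ z).2 (by omega), (h _ z).2 (by omega), completions_succ_pos s a ha]
      ring

theorem CountedBy.true_succ {k : ℕ} {c : Fin (k + 1) → Option Bool} (hc : c 0 = some true)
    {m s N : ℕ} (hs : s % 2 = 1) (h : CountedBy (fun i => c i.succ) 1 m s N) :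
    CountedBy c 0 m (s + 1) N := by
  intro a z
  rw [numWords_succ_true c hc]
  unfold numChord
  by_cases ha : a = 0
  · subst ha
    simp only [if_true]
    constructor
    · intro hz
      rw [(h 1 z).1 (by omega)]
    · intro hz
      rw [(h 1 z).2 (by omega), completions_odd_zero s hs]
      ring
  · simp only [ha, if_false]
    constructor
    · intro hz
      rw [(h _ z).1 (by omega), (h _ z).1 (by omega)]
    · intro hz
      rw [(h _ z).2 (by omega), (h _ z).2 (by omega), completions_succ_pos s a ha]
      ring

theorem completions_zero (a : ℕ) : completions 0 a = if a = 0 then 1 else 0 := by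
  unfold completions walksTo walksBelow
  split_ifs <;> omega

theorem CountedBy.false_succ {k : ℕ} {c : Fin (k + 1) → Option Bool} (hc : c 0 = some false)
    {m s N : ℕ} (h : CountedBy (fun i => c i.succ) 1 m s N) :
    CountedBy c 0 (m + 2) 0 (completions s 0 * N) := by
  intro a z
  rw [numWords_succ_false c hc, completions_zero]
  by_cases ha : a = 0
  · subst ha
    simp only [true_and, if_true]
    constructor
    · intro hz
      split_ifs with h0
      · exact (h 0 _).1 (by omega)
      · rfl
    · intro hz
      rw [if_pos (by omega), (h 0 _).2 (by omega), one_mul]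
  · simp [ha]

theorem exists_countedBy {j : ℕ} (w : Fin j → Bool) :
    ∃ r N, 4 ^ (Finset.univ.filter fun ℓ => w ℓ = true).card = 4 ^ r * N ∧
      ((∀ ℓ : Fin j, ℓ.val = 0 → w ℓ = false) → r = 0) ∧
      CountedBy (evenConstraint w) 0 (2 * (Finset.univ.filter fun ℓ => w ℓ = false).card)
        (2 * r) N := by
  induction j with
  | zero =>
    refine ⟨0, 1, by simp, fun _ => rfl, fun a z => ?_⟩
    have := numWords_zero (evenConstraint w) a z
    rw [show numWords (evenConstraint w) a z = _ from this, mul_zero, completions_zero]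
    simp only [Finset.univ_eq_empty, Finset.filter_empty, Finset.card_empty]
    split_ifs <;> omega
  | succ j ih =>
    obtain ⟨r, N, hN, -, h⟩ := ih (fun i => w i.succ)
    rw [← evenConstraint_tail] at h
    have h' := CountedBy.none_succ (c := fun i : Fin (2 * j + 1) => evenConstraint w i.succ)
      rfl (by omega) h
    have hones : (Finset.univ.filter fun ℓ => w ℓ = true).card =
        (if w 0 = true then 1 else 0) +
          (Finset.univ.filter fun ℓ : Fin j => w ℓ.succ = true).card := by
      rw [Finset.card_filter, Finset.card_filter, Fin.sum_univ_succ]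
    have hzeros : (Finset.univ.filter fun ℓ => w ℓ = false).card =
        (if w 0 = false then 1 else 0) +
          (Finset.univ.filter fun ℓ : Fin j => w ℓ.succ = false).card := by
      rw [Finset.card_filter, Finset.card_filter, Fin.sum_univ_succ]
    rw [hones, hzeros]
    cases hw : w 0 with
    | true =>
      refine ⟨r + 1, N, ?_, fun h0 => ?_, ?_⟩
      · rw [if_pos rfl, pow_add, hN]; ring
      · simp [h0 0 rfl] at hw
      · rw [if_neg (by decide), zero_add]
        exact CountedBy.true_succ (k := 2 * j + 1) (c := evenConstraint w)
          (by rw [evenConstraint_zero, hw]) (s := 2 * r + 1) (by omega) h'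
    | false =>
      refine ⟨0, 4 ^ r * N, ?_, fun _ => rfl, ?_⟩
      · rw [if_neg (by decide), zero_add, hN]; ring
      · have := CountedBy.false_succ (k := 2 * j + 1) (c := evenConstraint w)
          (by rw [evenConstraint_zero, hw]) h'
        rw [if_pos rfl, show ∀ x, 2 * (1 + x) = 2 * x + 2 from fun x => by ring]
        have h4 : completions (2 * r + 1) 0 = 4 ^ r := by
          rw [completions, if_neg (by omega)]
          exact walksBelow_odd_zero r
        rw [h4] at this
        exact this

/-- If the string starts with `0`, the words with the least possible number of bare points are
counted by a power of four. -/
theorem numWords_evenConstraint {j : ℕ} (w : Fin j → Bool)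
    (h0 : ∀ ℓ : Fin j, ℓ.val = 0 → w ℓ = false) :
    numWords (evenConstraint w) 0 (2 * (Finset.univ.filter fun ℓ => w ℓ = false).card) =
      4 ^ (Finset.univ.filter fun ℓ => w ℓ = true).card := by
  obtain ⟨r, N, hN, hr, h⟩ := exists_countedBy w
  obtain rfl := hr h0
  rw [hN, (h 0 _).2 (by omega), completions_zero]
  simp

end PointKind

/-- The kind of the left end of a chord of the given colour. -/
def ChordColor.kind : ChordColor → PointKind
  | red => .red
  | blue => .blue
  | black => .inner

/-- The pair `x < y` is matched with respect to the heights `A`: the height to the left of `x`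
recurs to the right of `y`, for the first time. -/
def IsChord (A : ℕ → ℕ) (x y : ℕ) : Prop :=
  x < y ∧ A (y + 1) = A x ∧ ∀ z, x < z → z ≤ y → A x < A z

namespace DiagramData

variable {m : ℕ}

theorem rel_eq (a y : Fin m) : rel a y = if a ≤ y then y.val - a.val else y.val + m - a.val := by
  unfold rel
  have ha := a.isLt
  have hy := y.isLt
  simp only [Fin.le_def]
  split_ifs with h
  · rw [show y.val + m - a.val = y.val - a.val + m by omega, Nat.add_mod_right,
      Nat.mod_eq_of_lt (by omega)]
  · rw [Nat.mod_eq_of_lt (by omega)]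

theorem insideCyc_iff (a c z : Fin m) : InsideCyc a c z ↔
    (a.val < z.val ∧ z.val < c.val) ∨ (c.val < a.val ∧ (a.val < z.val ∨ z.val < c.val)) := by
  unfold InsideCyc
  rw [rel_eq, rel_eq]
  simp only [Fin.le_def]
  have ha := a.isLt
  have hc := c.isLt
  have hz := z.isLt
  split_ifs <;> omega

theorem IsMatching.symm {b : DiagramData m} (hb : b.IsMatching) {x y : Fin m}
    (h : b.mate x = some y) : b.mate y = some x := hb.1 x y h

theorem IsMatching.val_ne {b : DiagramData m} (hb : b.IsMatching) {x y : Fin m}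
    (h : b.mate x = some y) : x.val ≠ y.val := by
  intro e
  obtain rfl := Fin.ext e
  exact hb.2 x h

theorem IsMatching.inj {b : DiagramData m} (hb : b.IsMatching) {x y z : Fin m}
    (h : b.mate x = some z) (h' : b.mate y = some z) : x = y := by
  have h1 := hb.symm h
  rw [hb.symm h'] at h1
  exact (Option.some_injective _ h1).symm

/-- The noncrossing condition in cyclic form. -/
theorem noncrossing_iff {b : DiagramData m} (hb : b.IsMatching) : b.Noncrossing ↔
    ∀ x y u v, b.mate x = some y → b.mate u = some v → InsideCyc x y u → InsideCyc x y v := by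
  constructor
  · intro hn x y u v hx hu h
    rw [insideCyc_iff] at h ⊢
    have hxy := hb.val_ne hx
    have hvx : v.val ≠ x.val := by
      intro e
      obtain rfl := Fin.ext e
      have := hb.symm hu
      rw [hx] at this
      obtain rfl := Option.some_injective _ this
      omega
    have hvy : v.val ≠ y.val := by
      intro e
      obtain rfl := Fin.ext e
      obtain rfl := hb.inj hx hu
      omega
    by_contra hv
    have key : ∀ {x y u v : Fin m}, b.mate x = some y → b.mate u = some v →
        ¬ (x.val < u.val ∧ u.val < y.val ∧ y.val < v.val) :=
      fun hx hu h => hn _ _ _ _ hx hu h.1 h.2.1 h.2.2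
    have h1 := key hx hu
    have h2 := key (hb.symm hu) hx
    have h3 := key (hb.symm hx) (hb.symm hu)
    have h4 := key hu (hb.symm hx)
    omega
  · intro h x y u v hx hu h1 h2 h3
    have := h x y u v hx hu
    rw [insideCyc_iff, insideCyc_iff] at this
    simp only [Fin.lt_def] at h1 h2 h3
    omega

/-- The role of the point `x`. -/
def kind (b : DiagramData m) (x : Fin m) : PointKind :=
  match b.mate x with
  | none => .bare
  | some y => if y < x then .close else (b.color x).kind

theorem kind_of_none {b : DiagramData m} {x : Fin m} (h : b.mate x = none) : b.kind x = .bare := by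
  simp [kind, h]

theorem kind_of_gt {b : DiagramData m} {x y : Fin m} (h : b.mate x = some y) (hxy : y < x) :
    b.kind x = .close := by
  simp [kind, h, hxy]

theorem kind_of_lt {b : DiagramData m} {x y : Fin m} (h : b.mate x = some y) (hxy : x < y) :
    b.kind x = (b.color x).kind := by
  simp [kind, h, hxy.le]

theorem kind_eq_bare_iff (b : DiagramData m) (x : Fin m) : b.kind x = .bare ↔ b.mate x = none := by
  unfold kind
  cases h : b.mate x with
  | none => simp
  | some y =>
    simp only [reduceCtorEq, iff_false]
    split_ifs
    · simp
    · cases b.color x <;> simp [ChordColor.kind]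

/-- The left ends of the chords passing over the gap to the left of the point `i`. -/
noncomputable def covering (b : DiagramData m) (i : ℕ) : Finset (Fin m) :=
  open Classical in
  Finset.univ.filter fun u => u.val < i ∧ ∃ v, b.mate u = some v ∧ i ≤ v.val

theorem mem_covering {b : DiagramData m} {i : ℕ} {u : Fin m} :
    u ∈ b.covering i ↔ u.val < i ∧ ∃ v, b.mate u = some v ∧ i ≤ v.val := by
  simp [covering]

/-- The number of chords passing over the gap to the left of the point `i`. -/
noncomputable def height (b : DiagramData m) (i : ℕ) : ℕ := (b.covering i).card

section Linear

variable {b : DiagramData m} {n : ℕ} (hb : b.MemB n) (h0 : ∀ x : Fin m, x.val = 0 → b.mate x = none)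

include hb

theorem isChord_height {x y : Fin m} (h : b.mate x = some y) (hxy : x < y) :
    IsChord b.height x y := by
  obtain ⟨hm, hn, -⟩ := hb
  rw [noncrossing_iff hm] at hn
  simp only [insideCyc_iff] at hn
  rw [Fin.lt_def] at hxy
  refine ⟨hxy, ?_, fun z hxz hzy => ?_⟩
  · unfold height
    congr 1
    ext u
    rw [mem_covering, mem_covering]
    constructor
    · rintro ⟨h1, v, h2, h3⟩
      have := hn x y u v h h2
      refine ⟨?_, v, h2, by omega⟩
      by_contra h4
      have h5 : u.val ≠ x.val := by
        intro e
        obtain rfl := Fin.ext e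
        rw [h2] at h
        obtain rfl := Option.some_injective _ h
        omega
      have h6 : u.val ≠ y.val := by
        intro e
        obtain rfl := Fin.ext e
        rw [hm.symm h] at h2
        obtain rfl := Option.some_injective _ h2
        omega
      omega
    · rintro ⟨h1, v, h2, h3⟩
      have := hn x y v u h (hm.symm h2)
      refine ⟨by omega, v, h2, ?_⟩
      by_contra h4
      have h5 : v.val ≠ x.val := by
        intro e
        obtain rfl := Fin.ext e
        rw [hm.symm h2] at h
        obtain rfl := Option.some_injective _ h
        omega
      have h6 : v.val ≠ y.val := by
        intro e
        obtain rfl := Fin.ext e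
        obtain rfl := hm.inj h h2
        omega
      omega
  · refine Finset.card_lt_card ⟨fun u hu => ?_, fun hs => ?_⟩
    · rw [mem_covering] at hu ⊢
      obtain ⟨h1, v, h2, h3⟩ := hu
      have := hn x y v u h (hm.symm h2)
      refine ⟨by omega, v, h2, ?_⟩
      have h5 : v.val ≠ x.val := by
        intro e
        obtain rfl := Fin.ext e
        rw [hm.symm h2] at h
        obtain rfl := Option.some_injective _ h
        omega
      omega
    · have := hs (mem_covering.2 ⟨hxz, y, h, hzy⟩)
      rw [mem_covering] at this
      omega

include h0

theorem lt_of_first {x y : Fin m} (hx : b.first x = true) (h : b.mate x = some y) :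
    x.val < y.val := by
  obtain ⟨hm, -, -, -, hi, -⟩ := hb
  by_contra hxy
  have hne := hm.val_ne h
  have hy0 : y.val ≠ 0 := fun e => by
    have := h0 y e
    rw [hm.symm h] at this
    cases this
  have := (hi.1 x y h hx ⟨0, x.pos⟩ (by rw [insideCyc_iff]; dsimp only; omega)).1
  rw [h0 _ rfl] at this
  cases this

theorem first_of_lt {x y : Fin m} (h : b.mate x = some y) (hxy : x.val < y.val)
    (hc : b.color x ≠ .black) : b.first x = true := by
  rw [hb.2.2.2.1.2 x y h hc]
  cases hy : b.first y with
  | false => rfl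
  | true =>
    have := lt_of_first hb h0 hy (hb.1.symm h)
    omega

theorem exists_outer {u v : Fin m} (h : b.mate u = some v)
    (hc : b.color u = .black) :
    ∃ x y, b.mate x = some y ∧ b.first x = true ∧ x.val < u.val ∧ v.val < y.val := by
  obtain ⟨x, y, h1, h2, h3, h4⟩ := hb.2.2.2.2.1.2 u v h hc
  have := lt_of_first hb h0 h2 h1
  rw [insideCyc_iff] at h3 h4
  exact ⟨x, y, h1, h2, by omega, by omega⟩

theorem black_of_covered {u v x : Fin m} (h : b.mate u = some v) (hux : u.val < x.val)
    (hxv : x.val < v.val) : (b.mate x).isSome ∧ b.color x = .black := by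
  by_cases hc : b.color u = .black
  · obtain ⟨p, q, h1, h2, h3, h4⟩ := exists_outer hb h0 h hc
    exact hb.2.2.2.2.1.1 p q h1 h2 x (by rw [insideCyc_iff]; omega)
  · exact hb.2.2.2.2.1.1 u v h (first_of_lt hb h0 h (by omega) hc) x
      (by rw [insideCyc_iff]; omega)

theorem isHeight_height : PointKind.IsHeight b.height b.kind := by
  have hm := hb.1
  constructor
  · rw [height, Finset.card_eq_zero, Finset.eq_empty_iff_forall_notMem]
    intro u hu
    obtain ⟨-, v, -, hv⟩ := mem_covering.1 hu
    have := v.isLt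
    omega
  intro i
  cases hi : b.mate i with
  | none =>
    rw [kind_of_none hi]
    constructor <;> rw [height, Finset.card_eq_zero, Finset.eq_empty_iff_forall_notMem] <;>
      intro u hu <;> obtain ⟨h1, v, h2, h3⟩ := mem_covering.1 hu
    · have hvi : v.val ≠ i.val := fun e => by
        obtain rfl := Fin.ext e
        simp [hm.symm h2] at hi
      simpa [hi] using (black_of_covered hb h0 h2 h1 (by omega)).1
    · have hui : u.val ≠ i.val := fun e => by
        obtain rfl := Fin.ext e
        simp [h2] at hi
      simpa [hi] using (black_of_covered hb h0 h2 (x := i) (by omega) (by omega)).1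
  | some y =>
    have hne := hm.val_ne hi
    by_cases hlt : i < y
    · rw [kind_of_lt hi hlt]
      have hstep : b.height (i + 1) = b.height i + 1 := by
        have hnot : i ∉ b.covering i := fun h => by
          have := (mem_covering.1 h).1
          omega
        unfold height
        rw [← Finset.card_insert_of_notMem hnot]
        congr 1
        ext u
        rw [Finset.mem_insert, mem_covering, mem_covering]
        constructor
        · rintro ⟨h1, v, h2, h3⟩
          by_cases hui : u = i
          · exact Or.inl hui
          · have : u.val ≠ i.val := fun e => hui (Fin.ext e)
            exact Or.inr ⟨by omega, v, h2, by omega⟩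
        · rintro (rfl | ⟨h1, v, h2, h3⟩)
          · exact ⟨by omega, y, hi, hlt⟩
          · refine ⟨by omega, v, h2, ?_⟩
            have hvi : v.val ≠ i.val := fun e => by
              obtain rfl := Fin.ext e
              rw [hm.symm h2] at hi
              obtain rfl := Option.some_injective _ hi
              rw [Fin.lt_def] at hlt
              omega
            omega
      have hzero : b.color i ≠ .black → b.height i = 0 := fun hc => by
        rw [height, Finset.card_eq_zero, Finset.eq_empty_iff_forall_notMem]
        intro u hu
        obtain ⟨h1, v, h2, h3⟩ := mem_covering.1 hu
        have hvi : v.val ≠ i.val := fun e => by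
          obtain rfl := Fin.ext e
          rw [hm.symm h2] at hi
          obtain rfl := Option.some_injective _ hi
          rw [Fin.lt_def] at hlt
          omega
        exact hc (black_of_covered hb h0 h2 h1 (by omega)).2
      cases hc : b.color i with
      | red =>
        have := hzero (by simp [hc])
        exact ⟨this, by rw [hstep, this]⟩
      | blue =>
        have := hzero (by simp [hc])
        exact ⟨this, by rw [hstep, this]⟩
      | black =>
        refine ⟨?_, hstep⟩
        obtain ⟨p, q, h1, -, h2, h3⟩ := exists_outer hb h0 hi hc
        rw [Fin.lt_def] at hlt
        exact Finset.card_pos.2 ⟨p, mem_covering.2 ⟨h2, q, h1, by omega⟩⟩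
    · have hlt' : y < i := by
        rw [Fin.lt_def] at hlt ⊢
        omega
      rw [kind_of_gt hi hlt']
      rw [Fin.lt_def] at hlt'
      have hnot : y ∉ b.covering (i + 1) := fun h => by
        obtain ⟨-, v, h2, h3⟩ := mem_covering.1 h
        rw [hm.symm hi] at h2
        obtain rfl := Option.some_injective _ h2
        omega
      change b.height i = b.height (i + 1) + 1
      unfold height
      rw [← Finset.card_insert_of_notMem hnot]
      congr 1
      ext u
      rw [Finset.mem_insert, mem_covering, mem_covering]
      constructor
      · rintro ⟨h1, v, h2, h3⟩
        by_cases hvi : v = i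
        · subst hvi
          exact Or.inl (hm.inj h2 (hm.symm hi))
        · have : v.val ≠ i.val := fun e => hvi (Fin.ext e)
          exact Or.inr ⟨by omega, v, h2, by omega⟩
      · rintro (rfl | ⟨h1, v, h2, h3⟩)
        · exact ⟨hlt', i, hm.symm hi, le_rfl⟩
        · refine ⟨?_, v, h2, by omega⟩
          have hui : u.val ≠ i.val := fun e => by
            obtain rfl := Fin.ext e
            rw [hi] at h2
            obtain rfl := Option.some_injective _ h2
            omega
          omega

end Linear

end DiagramData

theorem IsChord.right_unique {A : ℕ → ℕ} {x y y' : ℕ} (h : IsChord A x y) (h' : IsChord A x y') :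
    y = y' := by
  obtain ⟨h1, h2, h3⟩ := h
  obtain ⟨h1', h2', h3'⟩ := h'
  by_contra hne
  rcases Nat.lt_or_gt_of_ne hne with hlt | hlt
  · have := h3' (y + 1) (by omega) (by omega)
    omega
  · have := h3 (y' + 1) (by omega) (by omega)
    omega

theorem IsChord.left_unique {A : ℕ → ℕ} {x x' y : ℕ} (h : IsChord A x y) (h' : IsChord A x' y) :
    x = x' := by
  obtain ⟨h1, h2, h3⟩ := h
  obtain ⟨h1', h2', h3'⟩ := h'
  by_contra hne
  rcases Nat.lt_or_gt_of_ne hne with hlt | hlt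
  · have := h3 x' hlt (by omega)
    omega
  · have := h3' x hlt (by omega)
    omega

theorem IsChord.not_isChord {A : ℕ → ℕ} {x y z : ℕ} (h : IsChord A x y) : ¬ IsChord A y z := by
  intro h'
  have h1 := h.2.2 y h.1 le_rfl
  have h2 := h'.2.2 (y + 1) (by omega) h'.1
  have := h.2.1
  omega

theorem IsChord.congr {A A' : ℕ → ℕ} {k x y : ℕ} (hA : ∀ i ≤ k, A i = A' i) (hy : y < k)
    (h : IsChord A x y) : IsChord A' x y := by
  obtain ⟨h1, h2, h3⟩ := h
  refine ⟨h1, ?_, fun z hz hz' => ?_⟩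
  · rw [← hA _ (by omega), ← hA _ (by omega), h2]
  · rw [← hA _ (by omega), ← hA _ (by omega)]
    exact h3 z hz hz'

namespace PointKind

theorem Step.unique {s : PointKind} {a b c : ℕ} (h : s.Step a b) (h' : s.Step a c) : b = c := by
  cases s <;> simp only [Step] at h h' <;> omega

theorem IsHeight.unique {k : ℕ} {A A' : ℕ → ℕ} {t : Fin k → PointKind} (h : IsHeight A t)
    (h' : IsHeight A' t) (h0 : A 0 = A' 0) : ∀ i ≤ k, A i = A' i := by
  intro i
  induction i with
  | zero => exact fun _ => h0
  | succ i ih =>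
    intro hi
    have h1 := h.2 ⟨i, hi⟩
    have h2 := h'.2 ⟨i, hi⟩
    dsimp only at h1 h2
    rw [ih (by omega)] at h1
    exact h1.unique h2

end PointKind

namespace DiagramData

variable {m : ℕ}

theorem height_zero (b : DiagramData m) : b.height 0 = 0 := by
  rw [height, Finset.card_eq_zero, Finset.eq_empty_iff_forall_notMem]
  intro u hu
  have := (mem_covering.1 hu).1
  omega

theorem _root_.ChordColor.kind_ne_close (c : ChordColor) : c.kind ≠ .close := by
  cases c <;> simp [ChordColor.kind]

theorem _root_.ChordColor.kind_injective : Function.Injective ChordColor.kind := by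
  intro c d h
  cases c <;> cases d <;> simp_all [ChordColor.kind]

theorem kind_eq_close_iff {b : DiagramData m} (hm : b.IsMatching) {x y : Fin m}
    (h : b.mate x = some y) : b.kind x = .close ↔ y < x := by
  constructor
  · intro hk
    by_contra hlt
    have hne := hm.val_ne h
    rw [kind_of_lt h (by rw [Fin.lt_def] at hlt ⊢; omega)] at hk
    exact ChordColor.kind_ne_close _ hk
  · exact kind_of_gt h

theorem mate_eq_of_kind_eq {b b' : DiagramData m} {n n' : ℕ} (hb : b.MemB n) (hb' : b'.MemB n')
    (h0 : ∀ x : Fin m, x.val = 0 → b.mate x = none)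
    (h0' : ∀ x : Fin m, x.val = 0 → b'.mate x = none) (h : b.kind = b'.kind) :
    b.mate = b'.mate := by
  have hA : ∀ i ≤ m, b.height i = b'.height i :=
    (isHeight_height hb h0).unique (h ▸ isHeight_height hb' h0')
      (by rw [height_zero, height_zero])
  have key : ∀ x y, b.mate x = some y → x < y → b'.mate x = some y := by
    intro x y hx hxy
    have h1 : b'.kind x ≠ .bare := by
      rw [← h, Ne, kind_eq_bare_iff, hx]
      simp
    rw [Ne, kind_eq_bare_iff] at h1
    obtain ⟨y', hy'⟩ := Option.ne_none_iff_exists'.1 h1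
    have h2 : ¬ y' < x := by
      rw [← kind_eq_close_iff hb'.1 hy', ← h, kind_eq_close_iff hb.1 hx]
      exact hxy.le.not_gt
    have hne := hb'.1.val_ne hy'
    have hxy' : x < y' := by
      rw [Fin.lt_def] at h2 ⊢
      omega
    have h3 := (isChord_height hb hx hxy).congr hA y.isLt
    rw [hy', Fin.ext (h3.right_unique (isChord_height hb' hy' hxy'))]
  funext x
  cases hx : b.mate x with
  | none =>
    rw [← kind_eq_bare_iff, h, kind_eq_bare_iff] at hx
    exact hx.symm
  | some y =>
    rcases lt_trichotomy x y with hxy | hxy | hxy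
    · exact (key x y hx hxy).symm
    · exact absurd (congrArg Fin.val hxy) (hb.1.val_ne hx)
    · exact (hb'.1.symm (key y x (hb.1.symm hx) hxy)).symm

theorem eq_of_kind_eq {b b' : DiagramData m} {n n' : ℕ} (hb : b.MemB n) (hb' : b'.MemB n')
    (h0 : ∀ x : Fin m, x.val = 0 → b.mate x = none)
    (h0' : ∀ x : Fin m, x.val = 0 → b'.mate x = none) (h : b.kind = b'.kind) : b = b' := by
  have hmate := mate_eq_of_kind_eq hb hb' h0 h0' h
  have hlt : ∀ x y, b.mate x = some y → x < y → b.color x = b'.color x := by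
    intro x y hx hxy
    have := congrFun h x
    rw [kind_of_lt hx hxy, kind_of_lt (hmate ▸ hx) hxy] at this
    exact ChordColor.kind_injective this
  have hcolor : b.color = b'.color := by
    funext x
    cases hx : b.mate x with
    | none => rw [hb.2.2.1.2 x hx, hb'.2.2.1.2 x (hmate ▸ hx)]
    | some y =>
      rcases lt_trichotomy x y with hxy | hxy | hxy
      · exact hlt x y hx hxy
      · exact absurd (congrArg Fin.val hxy) (hb.1.val_ne hx)
      · rw [hb.2.2.1.1 x y hx, hb'.2.2.1.1 x y (hmate ▸ hx), hlt y x (hb.1.symm hx) hxy]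
  have hfirst : ∀ x, b.first x = true → b'.first x = true := by
    intro x hx
    obtain ⟨h1, h2⟩ := hb.2.2.2.1.1 x hx
    obtain ⟨y, hy⟩ := Option.isSome_iff_exists.1 h1
    exact first_of_lt hb' h0' (hmate ▸ hy) (lt_of_first hb h0 hx hy) (hcolor ▸ h2)
  have hfirst' : ∀ x, b'.first x = true → b.first x = true := by
    intro x hx
    obtain ⟨h1, h2⟩ := hb'.2.2.2.1.1 x hx
    obtain ⟨y, hy⟩ := Option.isSome_iff_exists.1 h1
    exact first_of_lt hb h0 (hmate ▸ hy) (lt_of_first hb' h0' hx hy) (hcolor ▸ h2)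
  have : b.first = b'.first := funext fun x => Bool.eq_iff_iff.2 ⟨hfirst x, hfirst' x⟩
  cases b
  cases b'
  simp_all

end DiagramData

namespace PointKind

variable {m : ℕ} {A : ℕ → ℕ} {t : Fin m → PointKind} (hA : IsHeight A t)

/-- The colour of a chord whose left end has the given kind. -/
def color : PointKind → ChordColor
  | red => .red
  | blue => .blue
  | _ => .black

include hA

theorem IsHeight.step_le {i : ℕ} (hi : i < m) : A (i + 1) ≤ A i + 1 ∧ A i ≤ A (i + 1) + 1 := by
  have h := hA.2 ⟨i, hi⟩
  cases hs : t ⟨i, hi⟩ <;> simp only [hs, Step] at h <;> omega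

theorem IsHeight.exists_right (x : Fin m) (hx : A x < A (x + 1)) :
    ∃ y : Fin m, IsChord A x y := by
  classical
  have hxm : x.val + 1 < m := by
    have : x.val + 1 ≠ m := fun e => by
      rw [e, hA.1] at hx
      omega
    omega
  have hex : ∃ y, x.val < y ∧ A (y + 1) ≤ A x := by
    refine ⟨m - 1, by omega, ?_⟩
    rw [Nat.sub_add_cancel (by omega), hA.1]
    omega
  have hfind := Nat.find_spec hex
  have hmin : ∀ z, z < Nat.find hex → x.val < z → A x < A (z + 1) := fun z hz hxz => by
    have := Nat.find_min hex hz
    omega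
  have hle : Nat.find hex ≤ m - 1 := Nat.find_min' hex (by
    refine ⟨by omega, ?_⟩
    rw [Nat.sub_add_cancel (by omega), hA.1]
    omega)
  generalize Nat.find hex = y at hfind hmin hle
  have hz : ∀ z, x.val < z → z ≤ y → A x < A z := fun z h1 h2 => by
    obtain ⟨z, rfl⟩ := Nat.exists_eq_succ_of_ne_zero (by omega : z ≠ 0)
    by_cases h3 : z = x.val
    · rwa [h3]
    · exact hmin z (by omega) (by omega)
  refine ⟨⟨y, by omega⟩, hfind.1, ?_, hz⟩
  have h1 := hz y hfind.1 le_rfl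
  have h2 := (hA.step_le (i := y) (by omega)).2
  dsimp only
  omega

theorem IsHeight.exists_left (h0 : A 0 = 0) (y : Fin m) (hy : A (y + 1) < A y) :
    ∃ x : Fin m, IsChord A x y := by
  classical
  set x := Nat.findGreatest (fun x => A x ≤ A (y + 1)) y with hx
  have hspec : A x ≤ A (y + 1) :=
    Nat.findGreatest_spec (P := fun x => A x ≤ A (y + 1)) (Nat.zero_le y) (by omega)
  have hle : x ≤ y := Nat.findGreatest_le _
  have hmax : ∀ z, x < z → z ≤ y → A (y + 1) < A z := fun z h1 h2 => by
    have := Nat.findGreatest_is_greatest (P := fun x => A x ≤ A (y + 1)) h1 h2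
    omega
  have hlt : x < y := by
    have : x ≠ y := fun e => by
      rw [e] at hspec
      omega
    omega
  have h1 := hmax (x + 1) (by omega) (by omega)
  have h2 := (hA.step_le (i := x) (by omega)).1
  have h3 : A (y + 1) = A x := by omega
  exact ⟨⟨x, by omega⟩, hlt, h3, fun z hz hz' => h3 ▸ hmax z hz hz'⟩

theorem IsHeight.kind_left {x : Fin m} {y : ℕ} (h : IsChord A x y) :
    t x ≠ bare ∧ t x ≠ close := by
  have h1 := h.2.2 (x + 1) (by omega) h.1
  have h2 := hA.2 x
  constructor <;> intro hs <;> simp only [hs, Step] at h2 <;> omega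

theorem IsHeight.kind_right {x : ℕ} {y : Fin m} (h : IsChord A x y) : t y = close := by
  have h1 := h.2.2 y h.1 le_rfl
  have h2 := hA.2 y
  have h3 := h.2.1
  cases hs : t y <;> simp only [hs, Step] at h2 <;> first | rfl | omega

theorem IsHeight.height_lt {x : Fin m} (h1 : t x ≠ bare) (h2 : t x ≠ close) :
    A x < A (x + 1) := by
  have h := hA.2 x
  cases hs : t x <;> simp only [hs, Step] at h <;> simp_all

theorem IsHeight.height_gt {x : Fin m} (h : t x = close) : A (x + 1) < A x := by
  have h' := hA.2 x
  simp only [h, Step] at h'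
  omega

theorem IsHeight.exists_outer (h0 : A 0 = 0) {p : Fin m} {q : ℕ} (h : IsChord A p q)
    (hp : A p ≠ 0) : ∃ x y : Fin m, IsChord A x y ∧ (t x = red ∨ t x = blue) ∧
      x < p ∧ q < y := by
  classical
  set x := Nat.findGreatest (fun x => A x = 0) p with hx
  have hspec : A x = 0 := Nat.findGreatest_spec (P := fun x => A x = 0) (Nat.zero_le p) h0
  have hle : x ≤ p := Nat.findGreatest_le _
  have hmax : ∀ z, x < z → z ≤ p → A z ≠ 0 := fun z h1 h2 =>
    Nat.findGreatest_is_greatest (P := fun x => A x = 0) h1 h2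
  have hlt : x < p := by
    have : x ≠ p := fun e => hp (e ▸ hspec)
    omega
  have hx1 := hmax (x + 1) (by omega) (by omega)
  obtain ⟨y, hy⟩ := hA.exists_right ⟨x, by omega⟩ (by dsimp only; omega)
  refine ⟨⟨x, by omega⟩, y, hy, ?_, hlt, ?_⟩
  · have h := hA.2 ⟨x, by omega⟩
    dsimp only at h
    rw [hspec] at h
    cases hs : t ⟨x, by omega⟩ <;> simp only [hs, Step] at h <;> first | omega | simp
  · obtain ⟨g1, g2, g3⟩ := h
    obtain ⟨k1, k2, k3⟩ := hy
    dsimp only at k1 k2 k3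
    rw [hspec] at k2
    by_contra hq
    have : ¬ y.val + 1 ≤ p := fun hyp => hmax _ (by omega) hyp k2
    by_cases hyq : y.val = q
    · rw [hyq, g2] at k2
      exact hp k2
    · have := g3 (y + 1) (by omega) (by omega)
      omega

end PointKind

namespace DiagramData

open PointKind

variable {m : ℕ}

/-- The diagram with the given word and height function. -/
noncomputable def ofWord (A : ℕ → ℕ) (t : Fin m → PointKind) : DiagramData m :=
  let mate : Fin m → Option (Fin m) := fun x =>
    open Classical in
    if h : ∃ y : Fin m, IsChord A x y ∨ IsChord A y x then some h.choose else none
  { mate := mate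
    color := fun x => if t x = close then ((mate x).elim .black fun y => (t y).color)
      else (t x).color
    first := fun x => decide (t x = red ∨ t x = blue) }

theorem ofWord_mate (A : ℕ → ℕ) (t : Fin m → PointKind) (x y : Fin m) :
    (ofWord A t).mate x = some y ↔ IsChord A x y ∨ IsChord A y x := by
  have huniq : ∀ y y' : Fin m, (IsChord A x y ∨ IsChord A y x) →
      (IsChord A x y' ∨ IsChord A y' x) → y = y' := by
    rintro y y' (h | h) (h' | h')
    · exact Fin.ext (h.right_unique h')
    · exact absurd h h'.not_isChord
    · exact absurd h' h.not_isChord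
    · exact Fin.ext (h.left_unique h')
  simp only [ofWord]
  split_ifs with h
  · rw [Option.some_inj]
    exact ⟨fun e => e ▸ h.choose_spec, fun h' => huniq _ _ h.choose_spec h'⟩
  · simp only [false_iff]
    exact fun h' => h ⟨y, h'⟩

section

variable {A : ℕ → ℕ} {t : Fin m → PointKind} (hA : IsHeight A t) (h0 : A 0 = 0)

include hA

theorem ofWord_color_left {x y : Fin m} (h : IsChord A x y) :
    (ofWord A t).color x = (t x).color := by
  simp [ofWord, (hA.kind_left h).2]

theorem ofWord_color_right {x y : Fin m} (h : IsChord A x y) :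
    (ofWord A t).color y = (t x).color := by
  have hm := (ofWord_mate A t y x).2 (Or.inr h)
  have : (ofWord A t).color y = (((ofWord A t).mate y).elim .black fun y => (t y).color) := by
    simp [ofWord, hA.kind_right h]
  rw [this, hm]
  rfl

theorem height_eq_zero_of_color {x : Fin m} (h : t x = red ∨ t x = blue) : A x = 0 := by
  have hs := hA.2 x
  rcases h with h | h <;> rw [h] at hs <;> exact hs.1

include h0

theorem ofWord_mate_eq_none {x : Fin m} : (ofWord A t).mate x = none ↔ t x = bare := by
  constructor
  · intro hx
    by_contra hb
    have hno : ∀ y, (ofWord A t).mate x ≠ some y := by simp [hx]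
    by_cases hc : t x = close
    · obtain ⟨y, hy⟩ := hA.exists_left h0 x (hA.height_gt hc)
      exact hno y ((ofWord_mate A t x y).2 (Or.inr hy))
    · obtain ⟨y, hy⟩ := hA.exists_right x (hA.height_lt hb hc)
      exact hno y ((ofWord_mate A t x y).2 (Or.inl hy))
  · intro hx
    by_contra hs
    obtain ⟨y, hy⟩ := Option.ne_none_iff_exists'.1 hs
    rcases (ofWord_mate A t x y).1 hy with h | h
    · exact (hA.kind_left h).1 hx
    · simp [hA.kind_right h] at hx

theorem ofWord_kind : (ofWord A t).kind = t := by
  funext x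
  cases hx : (ofWord A t).mate x with
  | none => rw [kind_of_none hx, (ofWord_mate_eq_none hA h0).1 hx]
  | some y =>
    rcases (ofWord_mate A t x y).1 hx with h | h
    · rw [kind_of_lt hx (Fin.lt_def.2 h.1), ofWord_color_left hA h]
      have := hA.kind_left h
      cases hs : t x <;> simp_all [PointKind.color, ChordColor.kind]
    · rw [kind_of_gt hx (Fin.lt_def.2 h.1), hA.kind_right h]

theorem ofWord_memB {n : ℕ}
    (hn : (Finset.univ.filter fun i => t i = bare).card + 2 * n = m) :
    (ofWord A t).MemB n := by
  have hcol : ∀ x : Fin m, (t x).color ≠ .black → t x = red ∨ t x = blue := by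
    intro x hx
    cases hs : t x <;> simp_all [PointKind.color]
  have hcol' : ∀ x : Fin m, t x = red ∨ t x = blue → (t x).color ≠ .black := by
    rintro x (hx | hx) <;> simp [hx, PointKind.color]
  have hfirst : ∀ x, (ofWord A t).first x = true ↔ t x = red ∨ t x = blue := by
    intro x
    simp [ofWord]
  have hleft : ∀ x y : Fin m, (ofWord A t).first x = true → (ofWord A t).mate x = some y →
      IsChord A x y := by
    intro x y hx hy
    refine ((ofWord_mate A t x y).1 hy).resolve_right fun h => ?_
    rw [hfirst, hA.kind_right h] at hx
    simp at hx
  refine ⟨⟨?_, ?_⟩, ?_, ⟨?_, ?_⟩, ⟨?_, ?_⟩, ⟨?_, ?_⟩, ?_⟩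
  · intro x y h
    rw [ofWord_mate] at h ⊢
    exact h.symm
  · intro x h
    rw [ofWord_mate] at h
    have := h.elim (fun h => h.1) (fun h => h.1)
    omega
  · intro x y u v hxy huv h1 h2 h3
    rw [ofWord_mate] at hxy huv
    rw [Fin.lt_def] at h1 h2 h3
    have hxy := hxy.resolve_right fun h => by have := h.1; omega
    have huv := huv.resolve_right fun h => by have := h.1; omega
    have g1 := hxy.2.2 u h1 h2.le
    have g2 := huv.2.2 (y + 1) (by omega) h3
    have g3 := hxy.2.1
    omega
  · intro x y h
    rcases (ofWord_mate A t x y).1 h with h | h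
    · rw [ofWord_color_left hA h, ofWord_color_right hA h]
    · rw [ofWord_color_left hA h, ofWord_color_right hA h]
  · intro x h
    rw [ofWord_mate_eq_none hA h0] at h
    simp [ofWord, h, PointKind.color]
  · intro x hx
    have hs : (ofWord A t).mate x ≠ none := by
      rw [Ne, ofWord_mate_eq_none hA h0]
      rw [hfirst] at hx
      rcases hx with hx | hx <;> simp [hx]
    obtain ⟨y, hy⟩ := Option.ne_none_iff_exists'.1 hs
    rw [ofWord_color_left hA (hleft x y hx hy), hy]
    exact ⟨rfl, hcol' x ((hfirst x).1 hx)⟩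
  · intro x y h hc
    rcases (ofWord_mate A t x y).1 h with h | h
    · rw [ofWord_color_left hA h] at hc
      rw [(hfirst x).2 (hcol x hc)]
      simp [ofWord, hA.kind_right h]
    · rw [ofWord_color_right hA h] at hc
      rw [(hfirst y).2 (hcol y hc)]
      simp [ofWord, hA.kind_right h]
  · intro x y h hx z hz
    have hxy := hleft x y hx h
    have hA0 := height_eq_zero_of_color hA ((hfirst x).1 hx)
    obtain ⟨g1, g2, g3⟩ := hxy
    rw [insideCyc_iff] at hz
    have hz' : x.val < z.val ∧ z.val < y.val := by omega
    have hAz := g3 z hz'.1 hz'.2.le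
    have hAz' := g3 (z + 1) (by omega) (by omega)
    have hs : (ofWord A t).mate z ≠ none := by
      rw [Ne, ofWord_mate_eq_none hA h0]
      intro hb
      have := hA.2 z
      rw [hb] at this
      have := this.1
      omega
    obtain ⟨u, hu⟩ := Option.ne_none_iff_exists'.1 hs
    refine ⟨by rw [hu]; rfl, ?_⟩
    by_contra hc
    rcases (ofWord_mate A t z u).1 hu with h | h
    · rw [ofWord_color_left hA h] at hc
      have := height_eq_zero_of_color hA (hcol _ hc)
      omega
    · rw [ofWord_color_right hA h] at hc
      have := height_eq_zero_of_color hA (hcol _ hc)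
      have := h.2.1
      omega
  · have key : ∀ p q : Fin m, IsChord A p q → (ofWord A t).color p = .black →
        ∃ x y, (ofWord A t).mate x = some y ∧ (ofWord A t).first x = true ∧
          InsideCyc x y p ∧ InsideCyc x y q := by
      intro p q h hc
      rw [ofWord_color_left hA h] at hc
      have hk := hA.kind_left h
      have hp : A p ≠ 0 := by
        have hs := hA.2 p
        cases ht : t p <;> simp only [ht, Step] at hs <;> simp_all [PointKind.color]
        omega
      obtain ⟨x, y, h1, h2, h3, h4⟩ := hA.exists_outer h0 h hp
      rw [Fin.lt_def] at h3
      have := h.1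
      refine ⟨x, y, (ofWord_mate A t x y).2 (Or.inl h1), (hfirst x).2 h2, ?_, ?_⟩ <;>
        rw [insideCyc_iff] <;> omega
    intro z w h hc
    rcases (ofWord_mate A t z w).1 h with h | h
    · exact key z w h hc
    · rw [ofWord_color_right hA h, ← ofWord_color_left hA h] at hc
      obtain ⟨x, y, h1, h2, h3, h4⟩ := key w z h hc
      exact ⟨x, y, h1, h2, h4, h3⟩
  · have hsplit := Finset.card_filter_add_card_filter_not (s := Finset.univ)
      (fun i : Fin m => t i = bare)
    rw [Finset.card_univ, Fintype.card_fin] at hsplit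
    have : (Finset.univ.filter fun x => ((ofWord A t).mate x).isSome) =
        Finset.univ.filter fun i : Fin m => ¬ t i = bare := by
      ext x
      rw [Finset.mem_filter, Finset.mem_filter, ← ofWord_mate_eq_none hA h0,
        Option.isSome_iff_ne_none]
    rw [this]
    omega

end

/-- Counting diagrams by their words, when the string starts with `0`. -/
theorem card_fiber_of_zero {n j : ℕ} (w : Fin j → Bool)
    (hw : (Finset.univ.filter fun ℓ : Fin j => w ℓ = true).card = n)
    (h0 : ∀ ℓ : Fin j, ℓ.val = 0 → w ℓ = false) :
    Nat.card {b : DiagramData (2 * j) // b.MemB n ∧ sMap b = w} = 4 ^ n := by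
  have hz := Finset.card_filter_add_card_filter_not (s := Finset.univ)
    (fun ℓ : Fin j => w ℓ = true)
  rw [Finset.card_univ, Fintype.card_fin, hw] at hz
  simp only [Bool.not_eq_true] at hz
  rw [← hw, ← numWords_evenConstraint w h0, numWords]
  have hbare : ∀ b : DiagramData (2 * j), sMap b = w →
      ∀ x : Fin (2 * j), x.val = 0 → b.mate x = none := by
    rintro b rfl x hx
    have := h0 ⟨0, by omega⟩ rfl
    simp only [sMap, Option.isSome_eq_false_iff, Option.isNone_iff_eq_none] at this
    rw [← this]
    congr 1
    exact Fin.ext hx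
  refine Nat.card_eq_of_bijective (fun b => ⟨b.1.kind, ?_, ?_, ?_⟩) ⟨?_, ?_⟩
  · exact ⟨_, height_zero b.1, isHeight_height b.2.1 (hbare _ b.2.2)⟩
  · intro i v hv
    simp only [evenConstraint] at hv
    split_ifs at hv with hi
    rw [Option.some_inj, ← b.2.2] at hv
    rw [← hv, Ne, kind_eq_bare_iff, ← Ne, ← Option.isSome_iff_ne_none]
    simp only [sMap]
    rw [show (⟨2 * (i.val / 2), by omega⟩ : Fin (2 * j)) = i from Fin.ext (by dsimp only; omega)]
  · have hcard := b.2.1.2.2.2.2.2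
    have hsplit := Finset.card_filter_add_card_filter_not (s := Finset.univ)
      (fun i : Fin (2 * j) => b.1.kind i = bare)
    rw [Finset.card_univ, Fintype.card_fin] at hsplit
    have : (Finset.univ.filter fun x => (b.1.mate x).isSome) =
        Finset.univ.filter fun i : Fin (2 * j) => ¬ b.1.kind i = bare := by
      ext x
      rw [Finset.mem_filter, Finset.mem_filter, kind_eq_bare_iff, Option.isSome_iff_ne_none]
    rw [← this] at hsplit
    omega
  · intro b b' hbb
    exact Subtype.ext (eq_of_kind_eq b.2.1 b'.2.1 (hbare _ b.2.2) (hbare _ b'.2.2)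
      (congrArg Subtype.val hbb))
  · rintro ⟨t, ⟨A, hA0, hA⟩, hc, hcard⟩
    refine ⟨⟨ofWord A t, ?_, ?_⟩, Subtype.ext (ofWord_kind hA hA0)⟩
    · rw [hw]
      exact ofWord_memB hA hA0 (by omega)
    · funext ℓ
      have := hc ⟨2 * ℓ.val, by omega⟩ (w ℓ) (by
        simp only [evenConstraint]
        rw [if_pos (by omega)]
        congr 2
        exact Fin.ext (by dsimp only; omega))
      rw [Ne, ← ofWord_mate_eq_none hA hA0, ← Ne, ← Option.isSome_iff_ne_none] at this
      exact Bool.eq_iff_iff.2 this.symm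

end DiagramData

namespace DiagramData

variable {m : ℕ}

/-- The diagram obtained by pulling back along a permutation of the points. -/
def relabel (σ : Equiv.Perm (Fin m)) (b : DiagramData m) : DiagramData m where
  mate x := (b.mate (σ x)).map σ.symm
  color x := b.color (σ x)
  first x := b.first (σ x)

theorem relabel_mate (σ : Equiv.Perm (Fin m)) (b : DiagramData m) (x y : Fin m) :
    (b.relabel σ).mate x = some y ↔ b.mate (σ x) = some (σ y) := by
  simp only [relabel, Option.map_eq_some_iff, Equiv.symm_apply_eq]
  exact ⟨fun ⟨z, h, e⟩ => e ▸ h, fun h => ⟨_, h, rfl⟩⟩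

theorem relabel_symm_relabel (σ : Equiv.Perm (Fin m)) (b : DiagramData m) :
    (b.relabel σ).relabel σ.symm = b := by
  cases b
  simp [relabel, Function.comp_def]

theorem isSome_mate_relabel (σ : Equiv.Perm (Fin m)) (b : DiagramData m) (x : Fin m) :
    ((b.relabel σ).mate x).isSome = (b.mate (σ x)).isSome :=
  Option.isSome_map

theorem MemB.relabel {σ : Equiv.Perm (Fin m)}
    (hσ : ∀ a c z, InsideCyc (σ a) (σ c) (σ z) ↔ InsideCyc a c z) {n : ℕ} {b : DiagramData m}
    (hb : b.MemB n) : (b.relabel σ).MemB n := by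
  obtain ⟨hm, hn, hc, hf, hi, hcard⟩ := hb
  have hm' : (b.relabel σ).IsMatching :=
    ⟨fun x y h => (relabel_mate ..).2 (hm.1 _ _ ((relabel_mate ..).1 h)),
      fun x h => hm.2 _ ((relabel_mate ..).1 h)⟩
  refine ⟨hm', (noncrossing_iff hm').2 fun x y u v hx hu h => ?_, ⟨fun x y h => ?_, fun x h => ?_⟩,
    ⟨fun x h => ?_, fun x y h hx => ?_⟩, ⟨fun x y h hx z hz => ?_, fun z w h hz => ?_⟩, ?_⟩
  · rw [relabel_mate] at hx hu
    exact (hσ _ _ _).1 ((noncrossing_iff hm).1 hn _ _ _ _ hx hu ((hσ _ _ _).2 h))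
  · exact hc.1 _ _ ((relabel_mate ..).1 h)
  · exact hc.2 _ (Option.map_eq_none_iff.1 h)
  · rw [isSome_mate_relabel]
    exact hf.1 _ h
  · exact hf.2 _ _ ((relabel_mate ..).1 h) hx
  · rw [isSome_mate_relabel]
    exact hi.1 _ _ ((relabel_mate ..).1 h) hx _ ((hσ _ _ _).2 hz)
  · obtain ⟨x, y, h1, h2, h3, h4⟩ := hi.2 _ _ ((relabel_mate ..).1 h) hz
    refine ⟨σ.symm x, σ.symm y, (relabel_mate ..).2 ?_, ?_, (hσ _ _ _).1 ?_, (hσ _ _ _).1 ?_⟩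
    · simpa using h1
    · simpa [DiagramData.relabel] using h2
    · simpa using h3
    · simpa using h4
  · rw [← hcard]
    exact Finset.card_equiv σ fun x => by simp [isSome_mate_relabel]

/-- Relabelling the points does not change the size of a fiber. -/
theorem card_fiber_comp {j : ℕ} {σ : Equiv.Perm (Fin (2 * j))} {τ : Equiv.Perm (Fin j)}
    (hσ : ∀ a c z, InsideCyc (σ a) (σ c) (σ z) ↔ InsideCyc a c z)
    (hτ : ∀ ℓ : Fin j, (σ ⟨2 * ℓ.val, by omega⟩).val = 2 * (τ ℓ).val) (n : ℕ) (w : Fin j → Bool) :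
    Nat.card {b : DiagramData (2 * j) // b.MemB n ∧ sMap b = w} =
      Nat.card {b : DiagramData (2 * j) // b.MemB n ∧ sMap b = w ∘ τ} := by
  have hσ' : ∀ a c z, InsideCyc (σ.symm a) (σ.symm c) (σ.symm z) ↔ InsideCyc a c z := by
    intro a c z
    rw [← hσ]
    simp only [Equiv.apply_symm_apply]
  have hs : ∀ b : DiagramData (2 * j), sMap (b.relabel σ) = sMap b ∘ τ := by
    intro b
    funext ℓ
    simp only [sMap, isSome_mate_relabel, Function.comp_apply, ← hτ, Fin.eta]
  refine Nat.card_congr (Equiv.subtypeEquiv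
    ⟨relabel σ, relabel σ.symm, relabel_symm_relabel σ, relabel_symm_relabel σ.symm⟩ fun b => ?_)
  simp only [Equiv.coe_fn_mk, hs, τ.surjective.right_cancellable]
  refine and_congr_left fun _ => ⟨MemB.relabel hσ, fun h => ?_⟩
  rw [← relabel_symm_relabel σ b]
  exact h.relabel hσ'

theorem insideCyc_add [NeZero m] (k a c z : Fin m) :
    InsideCyc (a + k) (c + k) (z + k) ↔ InsideCyc a c z := by
  rw [insideCyc_iff, insideCyc_iff]
  simp only [Fin.val_add_eq_ite]
  split_ifs <;> omega

end DiagramData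

/-- **Lemma (second half of Lemma `remove the 2s`).** For `n ≥ 0`, `j ≥ 2n`, and every
binary string `w` of length `j` with exactly `n` ones, the fiber of the map
`s : 𝓑_{n,2j} → {0,1}^j` over `w` has exactly `4^n` elements. -/
theorem fiber_of_string_card_four_pow (n j : ℕ) (h : 2 * n ≤ j) (w : Fin j → Bool)
    (hw : (Finset.univ.filter fun ℓ : Fin j => w ℓ = true).card = n) :
    Nat.card {b : DiagramData (2 * j) // b.MemB n ∧ sMap b = w} = 4 ^ n := by
  by_cases h0 : ∃ k, w k = false
  · obtain ⟨k, hk⟩ := h0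
    have : NeZero j := ⟨by have := k.isLt; omega⟩
    rw [DiagramData.card_fiber_comp (σ := Equiv.addRight ⟨2 * k.val, by omega⟩)
      (τ := Equiv.addRight k) (DiagramData.insideCyc_add _)]
    · refine DiagramData.card_fiber_of_zero _ ?_ fun ℓ hℓ => ?_
      · rw [← hw]
        exact Finset.card_equiv (Equiv.addRight k) fun ℓ => by
          simp only [Finset.mem_filter, Finset.mem_univ, true_and, Function.comp_apply]
      · rw [Fin.ext (b := 0) hℓ]
        simpa using hk
    · intro ℓ
      simp only [Equiv.coe_addRight, Fin.val_add_eq_ite]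
      split_ifs <;> omega
  · refine DiagramData.card_fiber_of_zero w hw fun ℓ _ => ?_
    have : (Finset.univ.filter fun ℓ : Fin j => w ℓ = true) = Finset.univ :=
      Finset.filter_true_of_mem fun ℓ _ => by
        by_contra hℓ
        exact h0 ⟨ℓ, Bool.eq_false_iff.2 hℓ⟩
    rw [this, Finset.card_univ, Fintype.card_fin] at hw
    omega
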